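/- There exist four smooth functions u₁, u₂, u₃, u₄ on [−T,T]×ℝ, each 2π-periodic in θ and linearly independent over ℝ, such that every nonzero linear combination u = c₁u₁ + c₂u₂ + c₃u₃ + c₄u₄ satisfies B(u,u) < −2·N₂(u). -/

import Mathlib

/-- The index form of the critical catenoid, for `2π`-periodic functions on `[-T,T] × ℝ`. -/
noncomputable def indexForm (T : ℝ) (u w : ℝ → ℝ → ℝ) : ℝ :=
  (∫ θ in (0:ℝ)..(2 * Real.pi), ∫ s in (-T)..T,
      (deriv (fun s' => u s' θ) s * deriv (fun s' => w s' θ) s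
        + deriv (fun θ' => u s θ') θ * deriv (fun θ' => w s θ') θ
        - 2 / (Real.cosh s) ^ 2 * u s θ * w s θ))
  - (1 / T) * ∫ θ in (0:ℝ)..(2 * Real.pi),
      (u T θ * w T θ + u (-T) θ * w (-T) θ)

/-- The squared `L²` norm on the critical catenoid (conformal factor `a² cosh² s`). -/
noncomputable def catL2 (T a : ℝ) (u : ℝ → ℝ → ℝ) : ℝ :=
  a ^ 2 * ∫ θ in (0:ℝ)..(2 * Real.pi), ∫ s in (-T)..T,
    (Real.cosh s) ^ 2 * (u s θ) ^ 2

open Real intervalIntegral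

/-- The quadratic form `B + 2 N₂` on the Fourier mode of angular eigenvalue `κ`,
polarized to a bilinear form on radial profiles. -/
noncomputable def modeForm (T a κ : ℝ) (f g : ℝ → ℝ) : ℝ :=
  (∫ s in (-T)..T, (deriv f s * deriv g s + κ * (f s * g s) - 2 / cosh s ^ 2 * (f s * g s)))
    + 2 * a ^ 2 * (∫ s in (-T)..T, cosh s ^ 2 * (f s * g s))
    - 1 / T * (f T * g T + f (-T) * g (-T))

lemma integral_symm_eq_zero_of_odd {h : ℝ → ℝ} (hodd : ∀ s, h (-s) = -h s) (T : ℝ) :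
    ∫ s in (-T)..T, h s = 0 := by
  have h1 := integral_comp_neg (a := -T) (b := T) h
  simp only [hodd, integral_neg, neg_neg] at h1
  linarith

lemma integral_linear_comb₃ {k₁ k₂ k₃ : ℝ → ℝ} (h₁ : Continuous k₁) (h₂ : Continuous k₂)
    (h₃ : Continuous k₃) (x₁ x₂ x₃ a b : ℝ) :
    ∫ s in a..b, (x₁ * k₁ s + x₂ * k₂ s + x₃ * k₃ s) =
      x₁ * (∫ s in a..b, k₁ s) + x₂ * (∫ s in a..b, k₂ s) + x₃ * ∫ s in a..b, k₃ s := by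
  have i₁ := (h₁.const_mul x₁).intervalIntegrable (μ := MeasureTheory.volume) a b
  have i₂ := (h₂.const_mul x₂).intervalIntegrable (μ := MeasureTheory.volume) a b
  have i₃ := (h₃.const_mul x₃).intervalIntegrable (μ := MeasureTheory.volume) a b
  rw [integral_add (i₁.add i₂) i₃, integral_add i₁ i₂]
  simp only [integral_const_mul]

lemma continuous_two_div_cosh_sq : Continuous fun s : ℝ => 2 / cosh s ^ 2 :=
  continuous_const.div (by fun_prop) fun s => (pow_pos (cosh_pos s) 2).ne'

lemma continuous_modeForm_integrand {f g : ℝ → ℝ} (hf : ContDiff ℝ (⊤ : ℕ∞) f)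
    (hg : ContDiff ℝ (⊤ : ℕ∞) g) (κ : ℝ) :
    Continuous fun s =>
      deriv f s * deriv g s + κ * (f s * g s) - 2 / cosh s ^ 2 * (f s * g s) := by
  have := hf.continuous
  have := hg.continuous
  have := hf.continuous_deriv (by simp)
  have := hg.continuous_deriv (by simp)
  have := continuous_two_div_cosh_sq
  fun_prop

lemma modeForm_add_const_mul (T a κ : ℝ) {f g : ℝ → ℝ} (hf : ContDiff ℝ (⊤ : ℕ∞) f)
    (hg : ContDiff ℝ (⊤ : ℕ∞) g) (ε : ℝ) :
    modeForm T a κ (fun s => f s + ε * g s) (fun s => f s + ε * g s) =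
      modeForm T a κ f f + 2 * ε * modeForm T a κ f g + ε ^ 2 * modeForm T a κ g g := by
  have hd : deriv (fun s => f s + ε * g s) = fun s => deriv f s + ε * deriv g s := by
    funext s
    have h1 := (hf.differentiable (by simp) s).hasDerivAt
    have h2 := (hg.differentiable (by simp) s).hasDerivAt
    exact (h1.add (h2.const_mul ε)).deriv
  have cf := hf.continuous
  have cg := hg.continuous
  have e1 := integral_linear_comb₃ (continuous_modeForm_integrand hf hf κ)
    (continuous_modeForm_integrand hf hg κ) (continuous_modeForm_integrand hg hg κ)
    1 (2 * ε) (ε ^ 2) (-T) T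
  have e2 := integral_linear_comb₃ (k₁ := fun s => cosh s ^ 2 * (f s * f s))
    (k₂ := fun s => cosh s ^ 2 * (f s * g s)) (k₃ := fun s => cosh s ^ 2 * (g s * g s))
    (by fun_prop) (by fun_prop) (by fun_prop)
    1 (2 * ε) (ε ^ 2) (-T) T
  unfold modeForm
  rw [hd]
  have r1 : (∫ s in (-T)..T, ((deriv f s + ε * deriv g s) * (deriv f s + ε * deriv g s)
      + κ * ((f s + ε * g s) * (f s + ε * g s))
      - 2 / cosh s ^ 2 * ((f s + ε * g s) * (f s + ε * g s)))) = _ :=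
    Eq.trans (integral_congr fun s _ => by ring) e1
  have r2 : (∫ s in (-T)..T, cosh s ^ 2 * ((f s + ε * g s) * (f s + ε * g s))) = _ :=
    Eq.trans (integral_congr fun s _ => by ring) e2
  rw [r1, r2]
  ring

/-- A null direction of the form that is not in its kernel can be perturbed to a negative one. -/
lemma exists_modeForm_neg {T a κ : ℝ} {f g : ℝ → ℝ} (hf : ContDiff ℝ (⊤ : ℕ∞) f)
    (hg : ContDiff ℝ (⊤ : ℕ∞) g) (hff : modeForm T a κ f f = 0)
    (hfg : modeForm T a κ f g ≠ 0) :
    ∃ ε : ℝ, modeForm T a κ (fun s => f s + ε * g s) (fun s => f s + ε * g s) < 0 := by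
  set l := modeForm T a κ f g
  set m := modeForm T a κ g g
  refine ⟨-l / (1 + |m|), ?_⟩
  rw [modeForm_add_const_mul T a κ hf hg, hff]
  have hpos : 0 < 1 + |m| := by positivity
  have hl : 0 < l ^ 2 := by positivity
  have hm : m ≤ |m| := le_abs_self m
  have key : 0 + 2 * (-l / (1 + |m|)) * l + (-l / (1 + |m|)) ^ 2 * m =
      l ^ 2 * (m - 2 * (1 + |m|)) / (1 + |m|) ^ 2 := by
    field_simp
    ring
  change 0 + 2 * (-l / (1 + |m|)) * l + (-l / (1 + |m|)) ^ 2 * m < 0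
  rw [key]
  apply div_neg_of_neg_of_pos _ (by positivity)
  nlinarith [abs_nonneg m]

/-- Green's identity for a radial Jacobi field `f`. -/
lemma modeForm_of_jacobi (T a : ℝ) {κ : ℝ} {f f' g : ℝ → ℝ}
    (hf : ∀ s, HasDerivAt f (f' s) s)
    (hf' : ∀ s, HasDerivAt f' (κ * f s - 2 / cosh s ^ 2 * f s) s)
    (hg : ContDiff ℝ (⊤ : ℕ∞) g) :
    modeForm T a κ f g = f' T * g T - f' (-T) * g (-T)
      + 2 * a ^ 2 * (∫ s in (-T)..T, cosh s ^ 2 * (f s * g s))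
      - 1 / T * (f T * g T + f (-T) * g (-T)) := by
  have hd : deriv f = f' := funext fun s => (hf s).deriv
  have cf : Continuous f := continuous_iff_continuousAt.2 fun s => (hf s).continuousAt
  have cf' : Continuous f' := continuous_iff_continuousAt.2 fun s => (hf' s).continuousAt
  have cg := hg.continuous
  have cg' := hg.continuous_deriv (by simp)
  have cV := continuous_two_div_cosh_sq
  unfold modeForm
  rw [hd, integral_eq_sub_of_hasDerivAt (f := fun s => f' s * g s)]
  · intro s _
    have := (hf' s).mul (hg.differentiable (by simp) s).hasDerivAt
    refine HasDerivAt.congr_deriv (this) ?_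
    ring
  · exact Continuous.intervalIntegrable (by fun_prop) _ _

lemma mul_sinh_eq_cosh {T : ℝ} (hTtanh : T * tanh T = 1) : T * sinh T = cosh T := by
  rw [tanh_eq_sinh_div_cosh] at hTtanh
  have := (cosh_pos T).ne'
  field_simp at hTtanh
  exact hTtanh

lemma hasDerivAt_sinh_div_cosh (s : ℝ) :
    HasDerivAt (fun s => sinh s / cosh s) (1 / cosh s ^ 2) s := by
  have hc := (cosh_pos s).ne'
  refine HasDerivAt.congr_deriv ((hasDerivAt_sinh s).div (hasDerivAt_cosh s) hc) ?_
  rw [← cosh_sq_sub_sinh_sq s]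
  ring

lemma hasDerivAt_inv_cosh_sq (s : ℝ) :
    HasDerivAt (fun s => 1 / cosh s ^ 2)
      (0 * (sinh s / cosh s) - 2 / cosh s ^ 2 * (sinh s / cosh s)) s := by
  have hc := (cosh_pos s).ne'
  refine HasDerivAt.congr_deriv
    ((hasDerivAt_const s (1:ℝ)).div ((hasDerivAt_cosh s).pow 2) (pow_ne_zero 2 hc)) ?_
  simp
  field_simp

lemma hasDerivAt_inv_cosh (s : ℝ) :
    HasDerivAt (fun s => 1 / cosh s) (-sinh s / cosh s ^ 2) s := by
  have hc := (cosh_pos s).ne'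
  refine HasDerivAt.congr_deriv ((hasDerivAt_const s (1:ℝ)).div (hasDerivAt_cosh s) hc) ?_
  ring

lemma hasDerivAt_neg_sinh_div_cosh_sq (s : ℝ) :
    HasDerivAt (fun s => -sinh s / cosh s ^ 2)
      (1 * (1 / cosh s) - 2 / cosh s ^ 2 * (1 / cosh s)) s := by
  have hc := (cosh_pos s).ne'
  refine HasDerivAt.congr_deriv
    (((hasDerivAt_sinh s).neg).div ((hasDerivAt_cosh s).pow 2) (pow_ne_zero 2 hc)) ?_
  simp
  field_simp
  have := cosh_sq_sub_sinh_sq s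
  linear_combination (-2) * this

lemma contDiff_sinh_div_cosh : ContDiff ℝ (⊤ : ℕ∞) fun s : ℝ => sinh s / cosh s :=
  contDiff_sinh.div contDiff_cosh fun s => (cosh_pos s).ne'

lemma contDiff_inv_cosh : ContDiff ℝ (⊤ : ℕ∞) fun s : ℝ => 1 / cosh s :=
  contDiff_const.div contDiff_cosh fun s => (cosh_pos s).ne'

lemma integral_cosh_sq_symm (T : ℝ) :
    ∫ s in (-T)..T, cosh s ^ 2 = T + sinh T * cosh T := by
  rw [integral_eq_sub_of_hasDerivAt (f := fun s => (s + sinh s * cosh s) / 2)]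
  · simp
    ring
  · intro s _
    refine HasDerivAt.congr_deriv
      (((hasDerivAt_id s).add ((hasDerivAt_sinh s).mul (hasDerivAt_cosh s))).div_const 2) ?_
    linear_combination (-1 / 2) * cosh_sq_sub_sinh_sq s
  · exact Continuous.intervalIntegrable (by fun_prop) _ _

lemma integral_sinh_sq_symm (T : ℝ) :
    ∫ s in (-T)..T, sinh s ^ 2 = sinh T * cosh T - T := by
  rw [integral_eq_sub_of_hasDerivAt (f := fun s => (sinh s * cosh s - s) / 2)]
  · simp
    ring
  · intro s _
    refine HasDerivAt.congr_deriv
      ((((hasDerivAt_sinh s).mul (hasDerivAt_cosh s)).sub (hasDerivAt_id s)).div_const 2) ?_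
    linear_combination (1 / 2) * cosh_sq_sub_sinh_sq s
  · exact Continuous.intervalIntegrable (by fun_prop) _ _

lemma integral_sinh_sq_mul_cosh (T : ℝ) :
    ∫ s in (-T)..T, (sinh s * cosh s) * (sinh s * (sinh T ^ 2 - sinh s ^ 2)) =
      4 / 15 * sinh T ^ 5 := by
  rw [integral_eq_sub_of_hasDerivAt
    (f := fun s => sinh T ^ 2 / 3 * sinh s ^ 3 - 1 / 5 * sinh s ^ 5)]
  · simp
    ring
  · intro s _
    refine HasDerivAt.congr_deriv ((((hasDerivAt_sinh s).pow 3).const_mul (sinh T ^ 2 / 3)).sub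
      (((hasDerivAt_sinh s).pow 5).const_mul (1 / 5))) ?_
    simp
    ring
  · exact Continuous.intervalIntegrable (by fun_prop) _ _

lemma modeForm_one_neg {T a : ℝ} (hT : 0 < T) (hTtanh : T * tanh T = 1)
    (ha : a = 1 / (T * cosh T)) :
    modeForm T a 0 (fun _ => 1) (fun _ => 1) < 0 := by
  have hTS := mul_sinh_eq_cosh hTtanh
  have hc := cosh_pos T
  have hs : 0 < sinh T := sinh_pos_iff.2 hT
  have e : ∫ s in (-T)..T, 2 / cosh s ^ 2 = 4 / T := by
    rw [integral_eq_sub_of_hasDerivAt (f := fun s => 2 * (sinh s / cosh s))]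
    · rw [sinh_neg, cosh_neg, ← hTS]
      field_simp
      ring
    · intro s _
      refine HasDerivAt.congr_deriv ((hasDerivAt_sinh_div_cosh s).const_mul 2) ?_
      ring
    · exact continuous_two_div_cosh_sq.intervalIntegrable _ _
  have : modeForm T a 0 (fun _ => 1) (fun _ => 1) = -4 / T := by
    have h1 := cosh_sq_sub_sinh_sq T
    simp only [modeForm, deriv_const, mul_one, mul_zero, zero_add, zero_sub, integral_neg, e,
      integral_cosh_sq_symm, ha]
    rw [← hTS] at h1 ⊢
    field_simp
    linear_combination (-2) * h1
  rw [this]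
  exact div_neg_of_neg_of_pos (by norm_num) hT

lemma exists_odd_modeForm_neg {T a : ℝ} (hT : 0 < T) (hTtanh : T * tanh T = 1)
    (ha : a = 1 / (T * cosh T)) :
    ∃ f : ℝ → ℝ, ContDiff ℝ (⊤ : ℕ∞) f ∧ (∀ s, f (-s) = -f s) ∧ modeForm T a 0 f f < 0 := by
  have hTS := mul_sinh_eq_cosh hTtanh
  have hc := cosh_pos T
  have hs : 0 < sinh T := sinh_pos_iff.2 hT
  have h1 := cosh_sq_sub_sinh_sq T
  have hg : ContDiff ℝ (⊤ : ℕ∞) fun s => sinh s * (sinh T ^ 2 - sinh s ^ 2) :=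
    contDiff_sinh.mul (contDiff_const.sub (contDiff_sinh.pow 2))
  have green {g : ℝ → ℝ} (hg : ContDiff ℝ (⊤ : ℕ∞) g) :=
    modeForm_of_jacobi T a hasDerivAt_sinh_div_cosh hasDerivAt_inv_cosh_sq hg
  have hff : modeForm T a 0 (fun s => sinh s / cosh s) (fun s => sinh s / cosh s) = 0 := by
    rw [green contDiff_sinh_div_cosh]
    have e : ∫ s in (-T)..T, cosh s ^ 2 * (sinh s / cosh s * (sinh s / cosh s)) =
        sinh T * cosh T - T := by
      rw [← integral_sinh_sq_symm]
      refine integral_congr fun s _ => ?_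
      have := (cosh_pos s).ne'
      field_simp
    rw [e, sinh_neg, cosh_neg, ha]
    rw [← hTS] at h1 ⊢
    field_simp
    ring
  have hfg : modeForm T a 0 (fun s => sinh s / cosh s)
      (fun s => sinh s * (sinh T ^ 2 - sinh s ^ 2)) ≠ 0 := by
    rw [green hg]
    have e : ∫ s in (-T)..T, cosh s ^ 2 * (sinh s / cosh s * (sinh s * (sinh T ^ 2 - sinh s ^ 2))) =
        4 / 15 * sinh T ^ 5 := by
      rw [← integral_sinh_sq_mul_cosh]
      refine integral_congr fun s _ => ?_
      have := (cosh_pos s).ne'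
      field_simp
    rw [e, sinh_neg, cosh_neg, ha]
    have : 0 < 2 * (1 / (T * cosh T)) ^ 2 * (4 / 15 * sinh T ^ 5) := by positivity
    convert this.ne' using 1
    ring
  obtain ⟨ε, hε⟩ := exists_modeForm_neg contDiff_sinh_div_cosh hg hff hfg
  refine ⟨_, contDiff_sinh_div_cosh.add (contDiff_const.mul hg), fun s => ?_, hε⟩
  simp only [sinh_neg, cosh_neg]
  ring

lemma exists_even_modeForm_neg {T a : ℝ} (hT : 0 < T) (hTtanh : T * tanh T = 1)
    (ha : a = 1 / (T * cosh T)) :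
    ∃ f : ℝ → ℝ, ContDiff ℝ (⊤ : ℕ∞) f ∧ (∀ s, f (-s) = f s) ∧ modeForm T a 1 f f < 0 := by
  have hTS := mul_sinh_eq_cosh hTtanh
  have hc := cosh_pos T
  have hs : 0 < sinh T := sinh_pos_iff.2 hT
  have h1 := cosh_sq_sub_sinh_sq T
  have hg : ContDiff ℝ (⊤ : ℕ∞) fun _ : ℝ => (1 : ℝ) := contDiff_const
  have green {g : ℝ → ℝ} (hg : ContDiff ℝ (⊤ : ℕ∞) g) :=
    modeForm_of_jacobi T a hasDerivAt_inv_cosh hasDerivAt_neg_sinh_div_cosh_sq hg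
  have hff : modeForm T a 1 (fun s => 1 / cosh s) (fun s => 1 / cosh s) = 0 := by
    rw [green contDiff_inv_cosh]
    have e : ∫ s in (-T)..T, cosh s ^ 2 * (1 / cosh s * (1 / cosh s)) = 2 * T := by
      rw [integral_congr (g := fun _ => (1 : ℝ))]
      · simp
        ring
      · intro s _
        have := (cosh_pos s).ne'
        field_simp
    rw [e, sinh_neg, cosh_neg, ha]
    rw [← hTS]
    field_simp
    ring
  have hfg : modeForm T a 1 (fun s => 1 / cosh s)
      (fun _ => 1) ≠ 0 := by
    rw [green hg]
    have e : ∫ s in (-T)..T, cosh s ^ 2 * (1 / cosh s * 1) = 2 * sinh T := by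
      rw [integral_congr (g := fun s => cosh s)]
      · rw [integral_eq_sub_of_hasDerivAt (f := sinh) (fun s _ => hasDerivAt_sinh s)
          (continuous_cosh.intervalIntegrable _ _), sinh_neg]
        ring
      · intro s _
        have := (cosh_pos s).ne'
        field_simp
    have : -4 / (T * cosh T * cosh T ^ 2) < 0 :=
      div_neg_of_neg_of_pos (by norm_num) (by positivity)
    rw [e, sinh_neg, cosh_neg, ha]
    convert this.ne using 1
    rw [← hTS] at h1 ⊢
    field_simp
    linear_combination (-4) * h1
  obtain ⟨ε, hε⟩ := exists_modeForm_neg contDiff_inv_cosh hg hff hfg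
  refine ⟨_, contDiff_inv_cosh.add (contDiff_const.mul hg), fun s => ?_, hε⟩
  simp only [cosh_neg]


/-- The mean of a quadratic expression in `c cos θ + d sin θ` and its derivative. -/
lemma integral_fourier_quadratic {h : ℝ → ℝ} (A B₁ C D c d : ℝ)
    (hh : ∀ θ, h θ = A + B₁ * (c * cos θ + d * sin θ)
      + C * (c * cos θ + d * sin θ) ^ 2 + D * (-c * sin θ + d * cos θ) ^ 2) :
    ∫ θ in (0:ℝ)..(2 * π), h θ = 2 * π * A + π * (c ^ 2 + d ^ 2) * (C + D) := by
  obtain rfl := funext hh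
  rw [integral_eq_sub_of_hasDerivAt (f := fun θ => A * θ + B₁ * (c * sin θ - d * cos θ)
    + (C * c ^ 2 + D * d ^ 2) * ((θ + sin θ * cos θ) / 2)
    + (C * d ^ 2 + D * c ^ 2) * ((θ - sin θ * cos θ) / 2) + (C - D) * (c * d) * sin θ ^ 2)]
  · simp
    ring
  · intro θ _
    have hs := hasDerivAt_sin θ
    have hc := hasDerivAt_cos θ
    have hi := hasDerivAt_id θ
    refine HasDerivAt.congr_deriv ((((hi.const_mul A).add
      (((hs.const_mul c).sub (hc.const_mul d)).const_mul B₁)).add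
      (((hi.add (hs.mul hc)).div_const 2).const_mul (C * c ^ 2 + D * d ^ 2))).add
      (((hi.sub (hs.mul hc)).div_const 2).const_mul (C * d ^ 2 + D * c ^ 2)) |>.add
      ((hs.pow 2).const_mul ((C - D) * (c * d)))) ?_
    simp
    linear_combination (-(C * c ^ 2 + D * d ^ 2 + C * d ^ 2 + D * c ^ 2) / 2) *
      sin_sq_add_cos_sq θ
  · exact Continuous.intervalIntegrable (by fun_prop) _ _

lemma deriv_even {g : ℝ → ℝ} (hg : ∀ s, g (-s) = g s) (s : ℝ) : deriv g (-s) = -deriv g s := by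
  have := deriv_comp_neg g s
  simp only [hg] at this
  linarith

lemma deriv_odd {f : ℝ → ℝ} (hf : ∀ s, f (-s) = -f s) (s : ℝ) : deriv f (-s) = deriv f s := by
  have := deriv_comp_neg f s
  simp only [hf, deriv.fun_neg] at this
  linarith

/-- The quadratic form of `α + β f + p g` and its angular part, with parity eliminating the
cross terms between `f` and the even profiles. -/
lemma integral_weighted_quadratic {f g w : ℝ → ℝ} (hf : Continuous f) (hg : Continuous g)
    (hw : Continuous w) (hfo : ∀ s, f (-s) = -f s) (hge : ∀ s, g (-s) = g s)
    (hwe : ∀ s, w (-s) = w s) (T α β p : ℝ) :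
    ∫ s in (-T)..T, w s * (α + β * f s + p * g s) ^ 2 =
      α ^ 2 * (∫ s in (-T)..T, w s) + β ^ 2 * (∫ s in (-T)..T, w s * (f s * f s))
        + p ^ 2 * (∫ s in (-T)..T, w s * (g s * g s))
        + p * (2 * α * ∫ s in (-T)..T, w s * g s) := by
  have h1 := integral_linear_comb₃ (k₁ := w) (k₂ := fun s => w s * (f s * f s))
    (k₃ := fun s => w s * (g s * g s)) hw (by fun_prop) (by fun_prop) (α ^ 2) (β ^ 2) (p ^ 2) (-T) T
  have h2 := integral_linear_comb₃ (k₁ := fun s => w s * g s) (k₂ := fun s => w s * f s)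
    (k₃ := fun s => w s * (f s * g s)) (by fun_prop) (by fun_prop) (by fun_prop)
    (2 * α * p) (2 * α * β) (2 * β * p) (-T) T
  rw [integral_symm_eq_zero_of_odd (h := fun s => w s * f s) (fun s => by simp [hfo, hwe]),
    integral_symm_eq_zero_of_odd (h := fun s => w s * (f s * g s))
      (fun s => by simp [hfo, hwe, hge])] at h2
  rw [integral_congr (g := fun s => (α ^ 2 * w s + β ^ 2 * (w s * (f s * f s))
    + p ^ 2 * (w s * (g s * g s))) + (2 * α * p * (w s * g s) + 2 * α * β * (w s * f s)
    + 2 * β * p * (w s * (f s * g s)))) (fun s _ => by ring)]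
  rw [integral_add (Continuous.intervalIntegrable (by fun_prop) _ _)
    (Continuous.intervalIntegrable (by fun_prop) _ _), h1, h2]
  ring


lemma modeForm_self {T a κ : ℝ} {f : ℝ → ℝ} (hf : ContDiff ℝ (⊤ : ℕ∞) f) :
    modeForm T a κ f f = (∫ s in (-T)..T, deriv f s * deriv f s)
      + κ * (∫ s in (-T)..T, f s * f s) - (∫ s in (-T)..T, 2 / cosh s ^ 2 * (f s * f s))
      + 2 * a ^ 2 * (∫ s in (-T)..T, cosh s ^ 2 * (f s * f s))
      - 1 / T * (f T * f T + f (-T) * f (-T)) := by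
  have := hf.continuous
  have := hf.continuous_deriv (by simp)
  have := continuous_two_div_cosh_sq
  have e := integral_linear_comb₃ (k₁ := fun s => deriv f s * deriv f s)
    (k₂ := fun s => f s * f s) (k₃ := fun s => 2 / cosh s ^ 2 * (f s * f s))
    (by fun_prop) (by fun_prop) (by fun_prop) 1 κ (-1) (-T) T
  rw [modeForm, integral_congr (g := fun s => 1 * (deriv f s * deriv f s) + κ * (f s * f s)
    + -1 * (2 / cosh s ^ 2 * (f s * f s))) (fun s _ => by ring), e]
  ring

/-- On the span of `1`, an odd radial profile, and an even profile times `cos θ` and `sin θ`,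
the form `B + 2 N₂` is diagonal. -/
lemma indexForm_add_two_mul_catL2 (T a : ℝ) {f g : ℝ → ℝ} (hf : ContDiff ℝ (⊤ : ℕ∞) f)
    (hg : ContDiff ℝ (⊤ : ℕ∞) g) (hfo : ∀ s, f (-s) = -f s) (hge : ∀ s, g (-s) = g s)
    (c₁ c₂ c₃ c₄ : ℝ) {u : ℝ → ℝ → ℝ}
    (hu : ∀ s θ, u s θ = c₁ + c₂ * f s + (c₃ * cos θ + c₄ * sin θ) * g s) :
    indexForm T u u + 2 * catL2 T a u =
      2 * π * (c₁ ^ 2 * modeForm T a 0 (fun _ => 1) (fun _ => 1) + c₂ ^ 2 * modeForm T a 0 f f)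
        + π * (c₃ ^ 2 + c₄ ^ 2) * modeForm T a 1 g g := by
  obtain rfl : u = fun s θ => c₁ + c₂ * f s + (c₃ * cos θ + c₄ * sin θ) * g s := by
    funext s θ
    exact hu s θ
  have cf := hf.continuous
  have cg := hg.continuous
  have cf' := hf.continuous_deriv (by simp)
  have cg' := hg.continuous_deriv (by simp)
  have cV := continuous_two_div_cosh_sq
  have ds (s θ : ℝ) : deriv (fun s' => c₁ + c₂ * f s' + (c₃ * cos θ + c₄ * sin θ) * g s') s =
      c₂ * deriv f s + (c₃ * cos θ + c₄ * sin θ) * deriv g s := by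
    have h1 := (hf.differentiable (by simp) s).hasDerivAt
    have h2 := (hg.differentiable (by simp) s).hasDerivAt
    exact (((h1.const_mul c₂).const_add c₁).add (h2.const_mul _)).deriv
  have dθ (s θ : ℝ) : deriv (fun θ' => c₁ + c₂ * f s + (c₃ * cos θ' + c₄ * sin θ') * g s) θ =
      (-c₃ * sin θ + c₄ * cos θ) * g s := by
    have h := ((((hasDerivAt_cos θ).const_mul c₃).add
      ((hasDerivAt_sin θ).const_mul c₄)).mul_const (g s)).const_add (c₁ + c₂ * f s)
    exact (h.congr_deriv (by ring)).deriv
  have grad (p r : ℝ) : ∫ s in (-T)..T, ((c₂ * deriv f s + p * deriv g s) *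
      (c₂ * deriv f s + p * deriv g s) + r * g s * (r * g s)
      - 2 / cosh s ^ 2 * (c₁ + c₂ * f s + p * g s) * (c₁ + c₂ * f s + p * g s)) =
      c₂ ^ 2 * (∫ s in (-T)..T, deriv f s * deriv f s)
        + p ^ 2 * (∫ s in (-T)..T, deriv g s * deriv g s)
        + r ^ 2 * (∫ s in (-T)..T, g s * g s)
        - ∫ s in (-T)..T, 2 / cosh s ^ 2 * (c₁ + c₂ * f s + p * g s) ^ 2 := by
    have e1 := integral_linear_comb₃ (k₁ := fun s => deriv f s * deriv f s)
      (k₂ := fun s => deriv g s * deriv g s) (k₃ := fun s => g s * g s)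
      (by fun_prop) (by fun_prop) (by fun_prop) (c₂ ^ 2) (p ^ 2) (r ^ 2) (-T) T
    have e2 := integral_linear_comb₃ (k₁ := fun s => deriv f s * deriv g s)
      (k₂ := fun s => 2 / cosh s ^ 2 * (c₁ + c₂ * f s + p * g s) ^ 2) (k₃ := fun _ => (0 : ℝ))
      (by fun_prop) (by fun_prop) (by fun_prop) (2 * c₂ * p) (-1) 0 (-T) T
    rw [integral_symm_eq_zero_of_odd (h := fun s => deriv f s * deriv g s)
      (fun s => by simp [deriv_odd hfo, deriv_even hge])] at e2
    rw [integral_congr (g := fun s => (c₂ ^ 2 * (deriv f s * deriv f s)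
      + p ^ 2 * (deriv g s * deriv g s) + r ^ 2 * (g s * g s))
      + (2 * c₂ * p * (deriv f s * deriv g s)
        + -1 * (2 / cosh s ^ 2 * (c₁ + c₂ * f s + p * g s) ^ 2) + 0 * 0)) (fun s _ => by ring)]
    rw [integral_add (Continuous.intervalIntegrable (by fun_prop) _ _)
      (Continuous.intervalIntegrable (by fun_prop) _ _), e1, e2]
    ring
  have pot (p : ℝ) := integral_weighted_quadratic cf cg cV hfo hge
    (fun s => by rw [cosh_neg]) T c₁ c₂ p
  have mass (p : ℝ) := integral_weighted_quadratic cf cg (continuous_cosh.pow 2) hfo hge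
    (fun s => by simp) T c₁ c₂ p
  simp only [Pi.pow_apply] at mass
  rw [modeForm_self hf, modeForm_self hg, modeForm_self contDiff_const]
  simp only [indexForm, catL2, ds, dθ, grad, pot, mass, hfo, hge, deriv_const, mul_one, mul_zero,
    integral_zero]
  generalize (∫ s in (-T)..T, deriv f s * deriv f s) = F₁
  generalize (∫ s in (-T)..T, deriv g s * deriv g s) = G₁
  generalize (∫ s in (-T)..T, f s * f s) = F₀
  generalize (∫ s in (-T)..T, g s * g s) = G₀
  generalize (∫ s in (-T)..T, 2 / cosh s ^ 2 * (f s * f s)) = FV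
  generalize (∫ s in (-T)..T, 2 / cosh s ^ 2 * (g s * g s)) = GV
  generalize (∫ s in (-T)..T, 2 / cosh s ^ 2 * g s) = HV
  generalize (∫ s in (-T)..T, 2 / cosh s ^ 2) = V
  generalize (∫ s in (-T)..T, cosh s ^ 2 * (f s * f s)) = FW
  generalize (∫ s in (-T)..T, cosh s ^ 2 * (g s * g s)) = GW
  generalize (∫ s in (-T)..T, cosh s ^ 2 * g s) = HW
  generalize (∫ s in (-T)..T, cosh s ^ 2) = W
  rw [integral_fourier_quadratic (c₂ ^ 2 * F₁ - c₁ ^ 2 * V - c₂ ^ 2 * FV)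
      (-(2 * c₁ * HV)) (G₁ - GV) G₀ c₃ c₄ fun θ => ?_,
    integral_fourier_quadratic (2 * (c₁ ^ 2 + c₂ ^ 2 * f T ^ 2))
      (4 * c₁ * g T) (2 * g T ^ 2) 0 c₃ c₄ fun θ => ?_,
    integral_fourier_quadratic (c₁ ^ 2 * W + c₂ ^ 2 * FW) (2 * c₁ * HW) GW 0 c₃ c₄ fun θ => ?_]
  all_goals ring

theorem four_eigenvalues_below_minus_two (T a : ℝ) (hT : 0 < T)
    (hTtanh : T * Real.tanh T = 1) (ha : a = 1 / (T * Real.cosh T)) :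
    ∃ u₁ u₂ u₃ u₄ : ℝ → ℝ → ℝ,
      (ContDiff ℝ (⊤ : ℕ∞) (Function.uncurry u₁)) ∧ (ContDiff ℝ (⊤ : ℕ∞) (Function.uncurry u₂)) ∧
      (ContDiff ℝ (⊤ : ℕ∞) (Function.uncurry u₃)) ∧ (ContDiff ℝ (⊤ : ℕ∞) (Function.uncurry u₄)) ∧
      (∀ s θ : ℝ, u₁ s (θ + 2 * Real.pi) = u₁ s θ) ∧
      (∀ s θ : ℝ, u₂ s (θ + 2 * Real.pi) = u₂ s θ) ∧
      (∀ s θ : ℝ, u₃ s (θ + 2 * Real.pi) = u₃ s θ) ∧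
      (∀ s θ : ℝ, u₄ s (θ + 2 * Real.pi) = u₄ s θ) ∧
      LinearIndependent ℝ ![u₁, u₂, u₃, u₄] ∧
      (∀ c₁ c₂ c₃ c₄ : ℝ, ¬(c₁ = 0 ∧ c₂ = 0 ∧ c₃ = 0 ∧ c₄ = 0) →
        indexForm T
            (fun s θ => c₁ * u₁ s θ + c₂ * u₂ s θ + c₃ * u₃ s θ + c₄ * u₄ s θ)
            (fun s θ => c₁ * u₁ s θ + c₂ * u₂ s θ + c₃ * u₃ s θ + c₄ * u₄ s θ)
          < -2 * catL2 T a
              (fun s θ => c₁ * u₁ s θ + c₂ * u₂ s θ + c₃ * u₃ s θ + c₄ * u₄ s θ)) := by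
  obtain ⟨f, hf, hfo, hf_neg⟩ := exists_odd_modeForm_neg hT hTtanh ha
  obtain ⟨g, hg, hge, hg_neg⟩ := exists_even_modeForm_neg hT hTtanh ha
  have h1_neg := modeForm_one_neg hT hTtanh ha
  set u₁ : ℝ → ℝ → ℝ := fun _ _ => 1 with hu₁
  set u₂ : ℝ → ℝ → ℝ := fun s _ => f s with hu₂
  set u₃ : ℝ → ℝ → ℝ := fun s θ => cos θ * g s with hu₃
  set u₄ : ℝ → ℝ → ℝ := fun s θ => sin θ * g s with hu₄
  have neg (c₁ c₂ c₃ c₄ : ℝ) (hc : ¬(c₁ = 0 ∧ c₂ = 0 ∧ c₃ = 0 ∧ c₄ = 0)) :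
      indexForm T
          (fun s θ => c₁ * u₁ s θ + c₂ * u₂ s θ + c₃ * u₃ s θ + c₄ * u₄ s θ)
          (fun s θ => c₁ * u₁ s θ + c₂ * u₂ s θ + c₃ * u₃ s θ + c₄ * u₄ s θ)
        < -2 * catL2 T a
            (fun s θ => c₁ * u₁ s θ + c₂ * u₂ s θ + c₃ * u₃ s θ + c₄ * u₄ s θ) := by
    have key := indexForm_add_two_mul_catL2 T a hf hg hfo hge c₁ c₂ c₃ c₄
      (u := fun s θ => c₁ * u₁ s θ + c₂ * u₂ s θ + c₃ * u₃ s θ + c₄ * u₄ s θ)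
      (fun s θ => by simp only [hu₁, hu₂, hu₃, hu₄]; ring)
    have hcase : 0 < c₁ ^ 2 ∨ 0 < c₂ ^ 2 ∨ 0 < c₃ ^ 2 + c₄ ^ 2 := by
      by_contra! h
      obtain ⟨h1, h2, h3⟩ := h
      exact hc ⟨by nlinarith, by nlinarith, by nlinarith [sq_nonneg c₃, sq_nonneg c₄],
        by nlinarith [sq_nonneg c₃, sq_nonneg c₄]⟩
    have n1 := mul_nonpos_of_nonneg_of_nonpos (sq_nonneg c₁) h1_neg.le
    have n2 := mul_nonpos_of_nonneg_of_nonpos (sq_nonneg c₂) hf_neg.le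
    have n3 := mul_nonpos_of_nonneg_of_nonpos
      (add_nonneg (sq_nonneg c₃) (sq_nonneg c₄)) hg_neg.le
    have : 2 * (c₁ ^ 2 * modeForm T a 0 (fun _ => 1) (fun _ => 1) + c₂ ^ 2 * modeForm T a 0 f f)
        + (c₃ ^ 2 + c₄ ^ 2) * modeForm T a 1 g g < 0 := by
      rcases hcase with h | h | h
      · linarith [mul_neg_of_pos_of_neg h h1_neg]
      · linarith [mul_neg_of_pos_of_neg h hf_neg]
      · linarith [mul_neg_of_pos_of_neg h hg_neg]
    linarith [mul_neg_of_pos_of_neg pi_pos this]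
  refine ⟨u₁, u₂, u₃, u₄, contDiff_const, hf.comp contDiff_fst,
    (contDiff_cos.comp contDiff_snd).mul (hg.comp contDiff_fst),
    (contDiff_sin.comp contDiff_snd).mul (hg.comp contDiff_fst),
    fun _ _ => rfl, fun _ _ => rfl, fun s θ => by simp [hu₃], fun s θ => by simp [hu₄], ?_, neg⟩
  rw [Fintype.linearIndependent_iff]
  intro c hc
  have hzero : (fun s θ => c 0 * u₁ s θ + c 1 * u₂ s θ + c 2 * u₃ s θ + c 3 * u₄ s θ) =
      fun _ _ => (0 : ℝ) := by
    rw [Fin.sum_univ_four] at hc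
    exact hc
  have hall : c 0 = 0 ∧ c 1 = 0 ∧ c 2 = 0 ∧ c 3 = 0 := by
    by_contra h
    have := neg _ _ _ _ h
    rw [hzero] at this
    simp [indexForm, catL2] at this
  obtain ⟨h0, h1, h2, h3⟩ := hall
  intro i
  fin_cases i <;> assumption
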